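/- For every ε > 0 and every real λ, there exists exactly one solution u of (∗) defined on all of ℝ with the properties u'(0) = 0, u(π/2) = 0, and u'(t) > 0 for all t ∈ (0, π/2). Moreover this solution satisfies u(0) < 0, u(π/2 + t) = −u(π/2 − t) for all t ∈ ℝ, and u is 2π-periodic. -/

import Mathlib

open Real Set

/-- `u` is a solution of the forced Duffing equation
`ε²·u'' = u³ − λ·u + cos t` on all of `ℝ`. -/
def IsDuffingSol (ε lam : ℝ) (u : ℝ → ℝ) : Prop :=
  ContDiff ℝ 2 u ∧
  ∀ t : ℝ, ε ^ 2 * deriv (deriv u) t = u t ^ 3 - lam * u t + Real.cos t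

open scoped NNReal Topology
open Filter

/-- A bounded, globally Lipschitz, continuous time-dependent vector field has global integral
curves. -/
theorem exists_global_integralCurve {E : Type*} [NormedAddCommGroup E] [NormedSpace ℝ E]
    [CompleteSpace E] {F : ℝ → E → E} {K L : ℝ≥0} (hK : ∀ t, LipschitzWith K (F t))
    (hc : ∀ x, Continuous fun t ↦ F t x) (hL : ∀ t x, ‖F t x‖ ≤ L) (x₀ : E) :
    ∃ γ : ℝ → E, γ 0 = x₀ ∧ ∀ t, HasDerivAt γ (F t (γ t)) t := by
  have hloc : ∀ n : ℕ, ∃ α : ℝ → E, α 0 = x₀ ∧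
      ∀ t ∈ Ioo (-((n : ℝ) + 1)) (n + 1), HasDerivAt α (F t (α t)) t := by
    intro n
    have hn : (0 : ℝ) ≤ n := n.cast_nonneg
    have hPL : IsPicardLindelof F (tmin := -((n : ℝ) + 1)) (tmax := n + 1)
        ⟨0, by constructor <;> linarith⟩ x₀ (L * (n + 1)) 0 L K :=
      { lipschitzOnWith := fun t _ ↦ (hK t).lipschitzOnWith
        continuousOn := fun x _ ↦ (hc x).continuousOn
        norm_le := fun t _ x _ ↦ hL t x
        mul_max_le := by simp }
    obtain ⟨α, h0, hα⟩ := hPL.exists_eq_forall_mem_Icc_hasDerivWithinAt₀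
    exact ⟨α, h0, fun t ht ↦
      (hα t (Ioo_subset_Icc_self ht)).hasDerivAt (Icc_mem_nhds ht.1 ht.2)⟩
  choose α h0 hα using hloc
  have hcons : ∀ n m : ℕ, n ≤ m → EqOn (α n) (α m) (Ioo (-((n : ℝ) + 1)) (n + 1)) := by
    intro n m hnm
    have hn : (0 : ℝ) ≤ n := n.cast_nonneg
    have hnm' : (n : ℝ) ≤ m := by exact_mod_cast hnm
    refine ODE_solution_unique_of_mem_Ioo (v := F) (s := fun _ ↦ univ) (K := K) (t₀ := 0)
      (fun t _ ↦ (hK t).lipschitzOnWith) ⟨by linarith, by linarith⟩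
      (fun t ht ↦ ⟨hα n t ht, mem_univ _⟩)
      (fun t ht ↦ ⟨hα m t ⟨by linarith [ht.1], by linarith [ht.2]⟩, mem_univ _⟩) ?_
    rw [h0, h0]
  have hγ : ∀ (m : ℕ) (s : ℝ), |s| < m → α ⌈|s|⌉₊ s = α m s := by
    intro m s hs
    have hle := Nat.le_ceil |s|
    refine hcons _ _ (Nat.ceil_le.2 hs.le) (abs_lt.1 ?_)
    linarith
  refine ⟨fun t ↦ α ⌈|t|⌉₊ t, by simp [h0], fun t ↦ ?_⟩
  obtain ⟨m, hm⟩ := exists_nat_gt |t|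
  have ht := abs_lt.1 hm
  have hd := hα m t ⟨by linarith [ht.1], by linarith [ht.2]⟩
  rw [← hγ m t hm] at hd
  refine hd.congr_of_eventuallyEq ?_
  filter_upwards [(isOpen_lt continuous_abs continuous_const).mem_nhds hm] with s hs
  exact hγ m s hs

/-- A critical point with positive second derivative is not a local maximum from the right. -/
theorem exists_lt_of_second_deriv_pos {h h' : ℝ → ℝ} {t b c : ℝ} (htb : t < b)
    (hd : ∀ s ∈ Ico t b, HasDerivAt h (h' s) s) (h0 : h' t = 0) (h2 : HasDerivAt h' c t)
    (hc : 0 < c) : ∃ s ∈ Ioo t b, h t < h s := by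
  have hslope : ∀ᶠ s in 𝓝[>] t, 0 < slope h' t s :=
    ((hasDerivAt_iff_tendsto_slope.1 h2).mono_left
      (nhdsWithin_mono _ fun s hs ↦ ne_of_gt hs)).eventually (lt_mem_nhds hc)
  obtain ⟨d, hd1, hd2⟩ := mem_nhdsGT_iff_exists_Ioo_subset.1 hslope
  have htd : t < d := hd1
  obtain ⟨s, hs1, hs2⟩ := exists_between (lt_min htb htd)
  have hsb := hs2.trans_le (min_le_left b d)
  have hsd := hs2.trans_le (min_le_right b d)
  have hmono : StrictMonoOn h (Icc t s) := by
    refine strictMonoOn_of_hasDerivWithinAt_pos (f' := h') (convex_Icc t s)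
      (fun x hx ↦ (hd x ⟨hx.1, hx.2.trans_lt hsb⟩).continuousAt.continuousWithinAt) ?_ ?_
    · intro x hx
      rw [interior_Icc] at hx
      exact (hd x ⟨hx.1.le, hx.2.trans hsb⟩).hasDerivWithinAt
    · intro x hx
      rw [interior_Icc] at hx
      have hx' : 0 < slope h' t x := hd2 ⟨hx.1, hx.2.trans hsd⟩
      rw [slope_def_field, h0, sub_zero] at hx'
      exact (div_pos_iff_of_pos_right (sub_pos.2 hx.1)).1 hx'
  exact ⟨s, ⟨hs1, hsb⟩, hmono (left_mem_Icc.2 hs1.le) (right_mem_Icc.2 hs1.le) hs1⟩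

/-- Truncation of a real number to `[-R, R]`. -/
def truncate (R x : ℝ) : ℝ := max (-R) (min R x)

theorem abs_truncate_le {R : ℝ} (hR : 0 ≤ R) (x : ℝ) : |truncate R x| ≤ R :=
  abs_le.2 ⟨le_max_left _ _, max_le (by linarith) (min_le_left _ _)⟩

theorem truncate_of_abs_le {R x : ℝ} (hx : |x| ≤ R) : truncate R x = x := by
  rw [truncate, min_eq_right (abs_le.1 hx).2, max_eq_right (abs_le.1 hx).1]

theorem truncate_of_le {R x : ℝ} (hR : 0 ≤ R) (hx : R ≤ x) : truncate R x = R := by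
  rw [truncate, min_eq_left hx, max_eq_right (by linarith)]

theorem truncate_neg {R : ℝ} (hR : 0 ≤ R) (x : ℝ) : truncate R (-x) = -truncate R x := by
  simp only [truncate]
  grind

theorem abs_truncate_sub_le (R x y : ℝ) : |truncate R x - truncate R y| ≤ |x - y| := by
  simp only [truncate]
  grind

theorem abs_cubic_sub_le {lam R a b : ℝ} (ha : |a| ≤ R) (hb : |b| ≤ R) :
    |(a ^ 3 - lam * a) - (b ^ 3 - lam * b)| ≤ (3 * R ^ 2 + |lam|) * |a - b| := by
  have h : (a ^ 3 - lam * a) - (b ^ 3 - lam * b) = (a ^ 2 + a * b + b ^ 2 - lam) * (a - b) := by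
    ring
  rw [h, abs_mul]
  refine mul_le_mul_of_nonneg_right ?_ (abs_nonneg _)
  have ha' := abs_le.1 ha
  have hb' := abs_le.1 hb
  have h1 : a ^ 2 ≤ R ^ 2 := sq_le_sq' ha'.1 ha'.2
  have h2 : b ^ 2 ≤ R ^ 2 := sq_le_sq' hb'.1 hb'.2
  have h3 := neg_abs_le lam
  have h4 := le_abs_self lam
  rw [abs_le]
  constructor <;> nlinarith [sq_nonneg (a - b), sq_nonneg (a + b)]

/-- The first-order vector field of `ε² w'' = w³ - λ w - cos t`, with position truncated to
`[-M, M]` and velocity truncated to `[-N, N]`. -/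
noncomputable def truncField (ε lam M N t : ℝ) (p : ℝ × ℝ) : ℝ × ℝ :=
  (truncate N p.2, (truncate M p.1 ^ 3 - lam * truncate M p.1 - cos t) / ε ^ 2)

theorem exists_lipschitzWith_truncField (ε lam N : ℝ) {M : ℝ} (hM : 0 ≤ M) :
    ∃ K : ℝ≥0, ∀ t, LipschitzWith K (truncField ε lam M N t) := by
  set B : ℝ := (3 * M ^ 2 + |lam|) / ε ^ 2 with hB
  have hB0 : 0 ≤ B := by positivity
  refine ⟨⟨1 + B, by positivity⟩, fun t ↦ LipschitzWith.of_dist_le_mul fun p q ↦ ?_⟩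
  have h1 : |p.1 - q.1| ≤ dist p q := by rw [← Real.dist_eq]; exact le_max_left _ _
  have h2 : |p.2 - q.2| ≤ dist p q := by rw [← Real.dist_eq]; exact le_max_right _ _
  have h0 : 0 ≤ dist p q := dist_nonneg
  rw [Prod.dist_eq]
  refine max_le ?_ ?_
  · rw [Real.dist_eq]
    refine (abs_truncate_sub_le N p.2 q.2).trans (h2.trans ?_)
    change _ ≤ (1 + B) * _
    nlinarith
  · rw [Real.dist_eq]
    change |(truncate M p.1 ^ 3 - lam * truncate M p.1 - cos t) / ε ^ 2 -
      (truncate M q.1 ^ 3 - lam * truncate M q.1 - cos t) / ε ^ 2| ≤ (1 + B) * _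
    rw [← sub_div, abs_div, abs_of_nonneg (sq_nonneg ε), sub_sub_sub_cancel_right]
    have h3 := abs_cubic_sub_le (lam := lam) (abs_truncate_le hM p.1) (abs_truncate_le hM q.1)
    have h4 := (abs_truncate_sub_le M p.1 q.1).trans h1
    calc _ ≤ (3 * M ^ 2 + |lam|) * |truncate M p.1 - truncate M q.1| / ε ^ 2 := by gcongr
      _ = B * |truncate M p.1 - truncate M q.1| := by rw [hB]; ring
      _ ≤ B * dist p q := by gcongr
      _ ≤ _ := by nlinarith

theorem abs_truncField_snd_le {ε lam M N : ℝ} (hM : 0 ≤ M) (t : ℝ) (p : ℝ × ℝ) :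
    |(truncField ε lam M N t p).2| ≤ (M ^ 3 + |lam| * M + 1) / ε ^ 2 := by
  have h := abs_truncate_le hM p.1
  change |(truncate M p.1 ^ 3 - lam * truncate M p.1 - cos t) / ε ^ 2| ≤ _
  rw [abs_div, abs_of_nonneg (sq_nonneg ε)]
  gcongr
  calc _ ≤ |truncate M p.1 ^ 3 - lam * truncate M p.1| + |cos t| := abs_sub _ _
    _ ≤ |truncate M p.1 ^ 3| + |lam * truncate M p.1| + |cos t| := by gcongr; exact abs_sub _ _
    _ ≤ _ := by
      rw [abs_pow, abs_mul]
      gcongr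
      exact abs_cos_le_one t

/-- The first-order system equivalent to `ε² w'' = w³ - λ w - cos t`; its solutions are the
negatives of the solutions of the Duffing equation. -/
def IsPhase (ε lam : ℝ) (w z : ℝ → ℝ) : Prop :=
  ∀ t, HasDerivAt w (z t) t ∧ HasDerivAt z ((w t ^ 3 - lam * w t - cos t) / ε ^ 2) t

/-- Second derivative test for a maximum on `[a, b]` that is not attained at `b`, the derivative
being zero at `a` in case the maximum is attained there. -/
theorem second_deriv_nonpos_of_max {h h' : ℝ → ℝ} {a b t c : ℝ} (ht : t ∈ Ico a b)
    (hd : ∀ s ∈ Icc a b, HasDerivAt h (h' s) s) (h0 : t = a → h' a = 0)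
    (h2 : HasDerivAt h' c t) (hmax : ∀ s ∈ Icc a b, h s ≤ h t) : c ≤ 0 := by
  by_contra! hc
  have hz : h' t = 0 := by
    rcases ht.1.eq_or_lt with rfl | hat
    · exact h0 rfl
    · have hloc : IsLocalMax h t := by
        filter_upwards [Icc_mem_nhds hat ht.2] with s hs using hmax s hs
      exact hloc.hasDerivAt_eq_zero (hd t ⟨hat.le, ht.2.le⟩)
  obtain ⟨s, hs, hlt⟩ := exists_lt_of_second_deriv_pos ht.2
    (fun s hs ↦ hd s ⟨ht.1.trans hs.1, hs.2.le⟩) hz h2 hc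
  exact hlt.not_ge (hmax s ⟨ht.1.trans hs.1.le, hs.2.le⟩)

theorem exists_truncField_solution (ε lam : ℝ) {M N : ℝ} (hM : 0 ≤ M) (hN : 0 ≤ N) (p : ℝ × ℝ) :
    ∃ γ : ℝ → ℝ × ℝ, γ 0 = p ∧ ∀ t, HasDerivAt γ (truncField ε lam M N t (γ t)) t := by
  obtain ⟨K, hK⟩ := exists_lipschitzWith_truncField ε lam N hM
  have hC : 0 ≤ (M ^ 3 + |lam| * M + 1) / ε ^ 2 := by positivity
  refine exists_global_integralCurve (L := ⟨N + (M ^ 3 + |lam| * M + 1) / ε ^ 2, by positivity⟩)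
    hK (fun x ↦ ?_) (fun t x ↦ ?_) p
  · unfold truncField
    fun_prop
  · rw [Prod.norm_def]
    refine max_le ?_ ?_
    · exact (abs_truncate_le hN x.2).trans (le_add_of_nonneg_right hC)
    · exact (abs_truncField_snd_le hM t x).trans (le_add_of_nonneg_left hN)

theorem truncField_solution_unique {ε lam M N : ℝ} (hM : 0 ≤ M) {γ η : ℝ → ℝ × ℝ} {t₀ : ℝ}
    (hγ : ∀ t, HasDerivAt γ (truncField ε lam M N t (γ t)) t)
    (hη : ∀ t, HasDerivAt η (truncField ε lam M N t (η t)) t) (h : γ t₀ = η t₀) : γ = η := by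
  obtain ⟨K, hK⟩ := exists_lipschitzWith_truncField ε lam N hM
  exact ODE_solution_unique_univ (s := fun _ ↦ univ) (fun t ↦ (hK t).lipschitzOnWith)
    (fun t ↦ ⟨hγ t, mem_univ _⟩) (fun t ↦ ⟨hη t, mem_univ _⟩) h

theorem isPhase_unique {ε lam : ℝ} {w₁ z₁ w₂ z₂ : ℝ → ℝ} (h₁ : IsPhase ε lam w₁ z₁)
    (h₂ : IsPhase ε lam w₂ z₂) (hw : w₁ 0 = w₂ 0) (hz : z₁ 0 = z₂ 0) : w₁ = w₂ := by
  ext t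
  have hbdd : ∀ f : ℝ → ℝ, (∀ s, ContinuousAt f s) →
      ∃ R, ∀ s ∈ Ioo (-(|t| + 1)) (|t| + 1), |f s| ≤ R := by
    intro f hf
    obtain ⟨R, hR⟩ := (isCompact_Icc (a := -(|t| + 1)) (b := |t| + 1)).exists_bound_of_continuousOn
      fun s _ ↦ (hf s).continuousWithinAt
    exact ⟨R, fun s hs ↦ hR s (Ioo_subset_Icc_self hs)⟩
  obtain ⟨R₁, hR₁⟩ := hbdd w₁ fun s ↦ (h₁ s).1.continuousAt
  obtain ⟨R₂, hR₂⟩ := hbdd w₂ fun s ↦ (h₂ s).1.continuousAt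
  obtain ⟨S₁, hS₁⟩ := hbdd z₁ fun s ↦ (h₁ s).2.continuousAt
  obtain ⟨S₂, hS₂⟩ := hbdd z₂ fun s ↦ (h₂ s).2.continuousAt
  have h0 : (0 : ℝ) ∈ Ioo (-(|t| + 1)) (|t| + 1) :=
    ⟨by linarith [abs_nonneg t], by linarith [abs_nonneg t]⟩
  set M := max R₁ R₂
  set N := max S₁ S₂
  have hM : 0 ≤ M := (abs_nonneg _).trans ((hR₁ 0 h0).trans (le_max_left _ _))
  obtain ⟨K, hK⟩ := exists_lipschitzWith_truncField ε lam N hM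
  have hsol : ∀ {w z : ℝ → ℝ} {s : ℝ}, IsPhase ε lam w z → |w s| ≤ M → |z s| ≤ N →
      HasDerivAt (fun s ↦ (w s, z s)) (truncField ε lam M N s (w s, z s)) s := by
    intro w z s h hws hzs
    have := (h s).1.prodMk (h s).2
    simpa only [truncField, truncate_of_abs_le hws, truncate_of_abs_le hzs] using this
  have heq := ODE_solution_unique_of_mem_Ioo (v := truncField ε lam M N) (s := fun _ ↦ univ)
    (f := fun s ↦ (w₁ s, z₁ s)) (g := fun s ↦ (w₂ s, z₂ s))
    (fun s _ ↦ (hK s).lipschitzOnWith) h0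
    (fun s hs ↦ ⟨hsol h₁ ((hR₁ s hs).trans (le_max_left _ _))
      ((hS₁ s hs).trans (le_max_left _ _)), mem_univ _⟩)
    (fun s hs ↦ ⟨hsol h₂ ((hR₂ s hs).trans (le_max_right _ _))
      ((hS₂ s hs).trans (le_max_right _ _)), mem_univ _⟩)
    (by simp only [hw, hz])
  have ht : t ∈ Ioo (-(|t| + 1)) (|t| + 1) :=
    ⟨by linarith [neg_abs_le t], by linarith [le_abs_self t]⟩
  exact congrArg Prod.fst (heq ht)

/-- Comparison of two positive solutions, through the monotonicity of their quotient. -/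
theorem isPhase_initial_le {ε lam : ℝ} (hε : 0 < ε) {w₁ z₁ w₂ z₂ : ℝ → ℝ}
    (h₁ : IsPhase ε lam w₁ z₁) (h₂ : IsPhase ε lam w₂ z₂) (hz₁ : z₁ 0 = 0) (hz₂ : z₂ 0 = 0)
    (he₁ : w₁ (π / 2) = 0) (he₂ : w₂ (π / 2) = 0)
    (hp₂ : ∀ t ∈ Ico 0 (π / 2), 0 < w₂ t) : w₁ 0 ≤ w₂ 0 := by
  by_contra! hlt
  have hpi := pi_div_two_pos
  have hc₁ : Continuous w₁ := continuous_iff_continuousAt.2 fun s ↦ (h₁ s).1.continuousAt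
  have hc₂ : Continuous w₂ := continuous_iff_continuousAt.2 fun s ↦ (h₂ s).1.continuousAt
  have hcomp : IsCompact (Icc 0 (π / 2) ∩ {t | w₁ t ≤ w₂ t}) :=
    isCompact_Icc.inter_right (isClosed_le hc₁ hc₂)
  obtain ⟨T, ⟨hT, hTle⟩, hmin⟩ := hcomp.exists_isLeast
    ⟨π / 2, right_mem_Icc.2 hpi.le, by simp [he₁, he₂]⟩
  have hTle : w₁ T ≤ w₂ T := hTle
  have hT0 : 0 < T := by
    refine lt_of_le_of_ne hT.1 fun h ↦ ?_
    rw [← h] at hTle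
    exact hTle.not_gt hlt
  have hgt : ∀ t ∈ Ico 0 T, w₂ t < w₁ t := by
    intro t ht
    by_contra! hle
    exact ht.2.not_ge (hmin ⟨⟨ht.1, ht.2.le.trans hT.2⟩, hle⟩)
  have hW : ∀ t, HasDerivAt (fun t ↦ z₁ t * w₂ t - z₂ t * w₁ t)
      ((w₁ t * w₂ t * (w₁ t ^ 2 - w₂ t ^ 2) + cos t * (w₁ t - w₂ t)) / ε ^ 2) t := by
    intro t
    refine (((h₁ t).2.mul (h₂ t).1).sub ((h₂ t).2.mul (h₁ t).1)).congr_deriv ?_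
    field_simp
    ring
  have hWmono : StrictMonoOn (fun t ↦ z₁ t * w₂ t - z₂ t * w₁ t) (Icc 0 T) := by
    refine strictMonoOn_of_hasDerivWithinAt_pos (convex_Icc 0 T)
      (fun t _ ↦ (hW t).continuousAt.continuousWithinAt) (fun t _ ↦ (hW t).hasDerivWithinAt) ?_
    intro t ht
    rw [interior_Icc] at ht
    have hp := hp₂ t ⟨ht.1.le, ht.2.trans_le hT.2⟩
    have hg := hgt t ⟨ht.1.le, ht.2⟩
    have hcos : 0 < cos t := cos_pos_of_mem_Ioo ⟨by linarith [ht.1], ht.2.trans_le hT.2⟩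
    have hsq : 0 < w₁ t ^ 2 - w₂ t ^ 2 := by nlinarith
    have hp1 : 0 < w₁ t := hp.trans hg
    have : 0 < w₁ t - w₂ t := sub_pos.2 hg
    positivity
  have hWpos : ∀ t ∈ Ioc 0 T, 0 < z₁ t * w₂ t - z₂ t * w₁ t := by
    intro t ht
    have := hWmono (left_mem_Icc.2 hT0.le) ⟨ht.1.le, ht.2⟩ ht.1
    simpa [hz₁, hz₂] using this
  have hTlt : T < π / 2 := by
    refine lt_of_le_of_ne hT.2 fun h ↦ ?_
    have := hWpos T ⟨hT0, le_rfl⟩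
    rw [h, he₁, he₂] at this
    simp at this
  have hpos : ∀ t ∈ Icc 0 T, 0 < w₂ t := fun t ht ↦ hp₂ t ⟨ht.1, ht.2.trans_lt hTlt⟩
  have hqd : ∀ t ∈ Icc 0 T, HasDerivAt (fun t ↦ w₁ t / w₂ t)
      ((z₁ t * w₂ t - z₂ t * w₁ t) / w₂ t ^ 2) t := by
    intro t ht
    refine ((h₁ t).1.div (h₂ t).1 (hpos t ht).ne').congr_deriv ?_
    ring
  have hq : StrictMonoOn (fun t ↦ w₁ t / w₂ t) (Icc 0 T) := by
    refine strictMonoOn_of_hasDerivWithinAt_pos (convex_Icc 0 T)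
      (fun t ht ↦ (hqd t ht).continuousAt.continuousWithinAt)
      (fun t ht ↦ (hqd t (interior_subset ht)).hasDerivWithinAt) ?_
    intro t ht
    rw [interior_Icc] at ht
    have := hpos t ⟨ht.1.le, ht.2.le⟩
    have := hWpos t ⟨ht.1, ht.2.le⟩
    positivity
  have h0T := hq (left_mem_Icc.2 hT0.le) (right_mem_Icc.2 hT0.le) hT0
  have hle1 : w₁ T / w₂ T ≤ 1 := (div_le_one (hpos T (right_mem_Icc.2 hT0.le))).2 hTle
  have hgt1 : 1 < w₁ 0 / w₂ 0 := (one_lt_div (hpos 0 (left_mem_Icc.2 hT0.le))).2 hlt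
  simp only at h0T
  linarith

/-- A positive solution on `[0, π/2)` with a flat start that vanishes at `π/2` is decreasing: its
logarithmic derivative has no nonnegative interior maximum. -/
theorem isPhase_velocity_neg {ε lam : ℝ} (hε : 0 < ε) {w z : ℝ → ℝ}
    (h : IsPhase ε lam w z) (hz : z 0 = 0) (he : w (π / 2) = 0)
    (hp : ∀ t ∈ Ico 0 (π / 2), 0 < w t) : ∀ t ∈ Ioo 0 (π / 2), z t < 0 := by
  intro t₀ ht₀
  by_contra! hnn
  obtain ⟨T, hT, hzT⟩ : ∃ T ∈ Ioo t₀ (π / 2), z T < 0 := by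
    obtain ⟨T, hT, hTd⟩ := exists_hasDerivAt_eq_slope w z ht₀.2
      (fun s _ ↦ (h s).1.continuousAt.continuousWithinAt) (fun s _ ↦ (h s).1)
    refine ⟨T, hT, ?_⟩
    rw [hTd, he]
    exact div_neg_of_neg_of_pos (by linarith [hp t₀ ⟨ht₀.1.le, ht₀.2⟩]) (by linarith [ht₀.2])
  have hT0 : 0 < T := ht₀.1.trans hT.1
  have hpos : ∀ s ∈ Icc 0 T, 0 < w s := fun s hs ↦ hp s ⟨hs.1, hs.2.trans_lt hT.2⟩
  set W : ℝ → ℝ := fun s ↦ (w s ^ 3 - lam * w s - cos s) / ε ^ 2 * w s - z s * z s with hWdef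
  have hqd : ∀ s ∈ Icc 0 T, HasDerivAt (fun s ↦ z s / w s) (W s / w s ^ 2) s :=
    fun s hs ↦ (h s).2.div (h s).1 (hpos s hs).ne'
  have hWd : ∀ s, HasDerivAt W ((2 * w s ^ 3 * z s + sin s * w s + cos s * z s) / ε ^ 2) s := by
    intro s
    have hf := (((((h s).1.pow 3).sub ((h s).1.const_mul lam)).sub (hasDerivAt_cos s)).div_const
      (ε ^ 2)).mul (h s).1
    refine (hf.sub ((h s).2.mul (h s).2)).congr_deriv ?_
    simp only [Pi.sub_apply, Pi.pow_apply]
    push_cast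
    field_simp
    ring
  obtain ⟨t₁, ht₁, hmax₁⟩ := isCompact_Icc.exists_isMaxOn (nonempty_Icc.2 hT0.le)
    fun s hs ↦ (hqd s hs).continuousAt.continuousWithinAt
  have ht₀mem : t₀ ∈ Icc 0 T := ⟨ht₀.1.le, hT.1.le⟩
  obtain ⟨t, ht, hmax⟩ : ∃ t ∈ Ioc 0 T, ∀ s ∈ Icc 0 T, z s / w s ≤ z t / w t := by
    rcases ht₁.1.eq_or_lt with h0 | h0
    · refine ⟨t₀, ⟨ht₀.1, hT.1.le⟩, fun s hs ↦ (hmax₁ hs).trans ?_⟩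
      simp only [← h0, hz, zero_div]
      exact div_nonneg hnn (hpos t₀ ht₀mem).le
    · exact ⟨t₁, ⟨h0, ht₁.2⟩, fun s hs ↦ hmax₁ hs⟩
  have htI : t ∈ Icc 0 T := ⟨ht.1.le, ht.2⟩
  have hwt := hpos t htI
  have hzt : 0 ≤ z t := by
    have h0 := (div_nonneg hnn (hpos t₀ ht₀mem).le).trans (hmax t₀ ht₀mem)
    by_contra! hneg
    exact h0.not_gt (div_neg_of_neg_of_pos hneg hwt)
  have htT : t < T := by
    refine lt_of_le_of_ne ht.2 fun h ↦ ?_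
    rw [h] at hzt
    exact hzt.not_gt hzT
  have hWt : W t = 0 := by
    have hloc : IsLocalMax (fun s ↦ z s / w s) t := by
      filter_upwards [Icc_mem_nhds ht.1 htT] with s hs using hmax s hs
    have := hloc.hasDerivAt_eq_zero (hqd t htI)
    exact (div_eq_zero_iff.1 this).resolve_right (pow_ne_zero 2 hwt.ne')
  have h2 := (hWd t).div ((h t).1.pow 2) (pow_ne_zero 2 hwt.ne')
  have hle := second_deriv_nonpos_of_max ⟨ht.1.le, htT⟩ hqd (fun h ↦ absurd h ht.1.ne') h2 hmax
  refine hle.not_gt ?_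
  rw [hWt, zero_mul, sub_zero]
  have hsin : 0 < sin t := sin_pos_of_mem_Ioo ⟨ht.1, by linarith [hT.2, pi_pos]⟩
  have hcos : 0 < cos t := cos_pos_of_mem_Ioo ⟨by linarith [ht.1, pi_pos], by linarith [hT.2]⟩
  simp only [Pi.pow_apply]
  positivity

/-- Shooting: some truncated trajectory starting at rest is positive on `[0, π/2)` and vanishes at
`π/2`. -/
theorem exists_shooting {ε lam M N : ℝ} (hε : 0 < ε) (hM : 0 ≤ M) (hMlam : 1 < M ^ 3 - lam * M)
    (hN : N = 2 * ((M ^ 3 + |lam| * M + 1) / ε ^ 2)) :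
    ∃ γ : ℝ → ℝ × ℝ, (∀ t, HasDerivAt γ (truncField ε lam M N t (γ t)) t) ∧ (γ 0).2 = 0 ∧
      (γ (π / 2)).1 = 0 ∧ (∀ t ∈ Ico 0 (π / 2), 0 < (γ t).1) ∧
      ∀ t ∈ Icc 0 (π / 2), |(γ t).1| ≤ M ∧ |(γ t).2| ≤ N := by
  have hpi := pi_div_two_pos
  have hpi2 : π / 2 ≤ 2 := by linarith [pi_le_four]
  have hC0 : 0 ≤ (M ^ 3 + |lam| * M + 1) / ε ^ 2 := by positivity
  have hN0 : 0 ≤ N := by rw [hN]; positivity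
  choose γ hγ0 hγ using fun a : ℝ ↦ exists_truncField_solution ε lam hM hN0 (a, 0)
  have hz : ∀ a s, HasDerivAt (fun s ↦ (γ a s).2) (truncField ε lam M N s (γ a s)).2 s :=
    fun a s ↦ (hγ a s).snd
  have hzN : ∀ a, ∀ t ∈ Icc (0 : ℝ) (π / 2), |(γ a t).2| ≤ N := by
    intro a t ht
    have hb := Convex.norm_image_sub_le_of_norm_hasDerivWithin_le (s := univ)
      (fun s _ ↦ (hz a s).hasDerivWithinAt) (fun s _ ↦ abs_truncField_snd_le hM s (γ a s))
      convex_univ (mem_univ 0) (mem_univ t)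
    simp only [hγ0, sub_zero, Real.norm_eq_abs, abs_of_nonneg ht.1] at hb
    rw [hN]
    nlinarith [ht.2]
  have hw : ∀ a, ∀ s ∈ Icc (0 : ℝ) (π / 2), HasDerivAt (fun s ↦ (γ a s).1) (γ a s).2 s := by
    intro a s hs
    have h := (hγ a s).fst
    rwa [truncField, truncate_of_abs_le (hzN a s hs)] at h
  have hcw : ∀ a, Continuous fun s ↦ (γ a s).1 := fun a ↦
    continuous_fst.comp (continuous_iff_continuousAt.2 fun s ↦ (hγ a s).continuousAt)
  have hbelow : ∀ a, ∀ t ∈ Icc (0 : ℝ) (π / 2), (γ a t).1 < M →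
      ∀ s ∈ Icc 0 t, (γ a s).1 < M := by
    intro a t ht htM s hs
    by_contra! hsM
    obtain ⟨t₁, ht₁, hmax⟩ := isCompact_Icc.exists_isMaxOn ⟨s, hs⟩ (hcw a).continuousOn
    have ht₁M : M ≤ (γ a t₁).1 := hsM.trans (hmax hs)
    have hlt : t₁ < t := by
      refine lt_of_le_of_ne ht₁.2 fun h ↦ ?_
      rw [h] at ht₁M
      exact ht₁M.not_gt htM
    have hle := second_deriv_nonpos_of_max ⟨ht₁.1, hlt⟩
      (fun r hr ↦ hw a r ⟨hr.1, hr.2.trans ht.2⟩) (fun _ ↦ by simp [hγ0]) (hz a t₁)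
      fun r hr ↦ hmax hr
    refine hle.not_gt ?_
    simp only [truncField, truncate_of_le hM ht₁M]
    have := cos_le_one t₁
    exact div_pos (by linarith) (by positivity)
  obtain ⟨K, hK⟩ := exists_lipschitzWith_truncField ε lam N hM
  have hcont : ContinuousOn (fun p : ℝ × ℝ ↦ (γ p.1 p.2).1) (univ ×ˢ Icc 0 (π / 2)) := by
    refine continuousOn_prod_of_continuousOn_lipschitzOnWith _
      ⟨Real.exp (K * (π / 2)), (Real.exp_pos _).le⟩
      (fun a _ ↦ (hcw a).continuousOn) fun t ht ↦ LipschitzOnWith.of_dist_le_mul fun a _ b _ ↦ ?_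
    have hd := dist_le_of_trajectories_ODE (a := 0) (b := π / 2) (δ := dist a b) hK
      (fun s _ ↦ (hγ a s).continuousAt.continuousWithinAt)
      (fun s _ ↦ (hγ a s).hasDerivWithinAt)
      (fun s _ ↦ (hγ b s).continuousAt.continuousWithinAt)
      (fun s _ ↦ (hγ b s).hasDerivWithinAt)
      (by rw [hγ0, hγ0, Prod.dist_eq]; simp) t ht
    calc dist (γ a t).1 (γ b t).1 ≤ dist (γ a t) (γ b t) := le_max_left _ _
      _ ≤ dist a b * Real.exp (K * (t - 0)) := hd
      _ ≤ dist a b * Real.exp (K * (π / 2)) := by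
        gcongr
        linarith [ht.2]
      _ = _ := mul_comm _ _
  have hSc : IsCompact (Prod.fst '' ((Icc 0 M ×ˢ Icc 0 (π / 2)) ∩
      (fun p : ℝ × ℝ ↦ (γ p.1 p.2).1) ⁻¹' Iic 0)) := by
    refine IsCompact.image ?_ continuous_fst
    refine (isCompact_Icc.prod isCompact_Icc).of_isClosed_subset ?_ inter_subset_left
    exact (hcont.mono (prod_mono_left (subset_univ _))).preimage_isClosed_of_isClosed
      (isClosed_Icc.prod isClosed_Icc) isClosed_Iic
  obtain ⟨a, ⟨⟨a', t₀⟩, ⟨⟨haM, ht₀⟩, hat₀⟩, rfl⟩, hub⟩ := hSc.exists_isGreatest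
    ⟨0, (0, 0), ⟨⟨⟨le_rfl, hM⟩, ⟨le_rfl, hpi.le⟩⟩, by simp [hγ0]⟩, rfl⟩
  simp only [mem_preimage, mem_Iic] at haM ht₀ hat₀ hub
  have hM0 : 0 < M := by
    rcases hM.eq_or_lt with h | h
    · rw [← h] at hMlam
      norm_num at hMlam
    · exact h
  have haltM : a' < M := by
    have := hbelow a' t₀ ht₀ (hat₀.trans_lt hM0) 0 ⟨le_rfl, ht₀.1⟩
    simpa [hγ0] using this
  have hnn : ∀ t ∈ Icc 0 (π / 2), 0 ≤ (γ a' t).1 := by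
    intro t ht
    have hct : Continuous fun b ↦ (γ b t).1 :=
      continuousOn_univ.1 (hcont.comp (f := fun b : ℝ ↦ (b, t)) (by fun_prop)
        fun b _ ↦ ⟨mem_univ _, ht⟩)
    refine ge_of_tendsto (hct.continuousWithinAt (s := Ioi a')) ?_
    filter_upwards [Ioo_mem_nhdsGT haltM] with b hb
    by_contra! hneg
    exact hb.1.not_ge (hub ⟨(b, t), ⟨⟨⟨haM.1.trans hb.1.le, hb.2.le⟩, ht⟩, hneg.le⟩, rfl⟩)
  have hpos : ∀ t ∈ Ico 0 (π / 2), 0 < (γ a' t).1 := by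
    intro t ht
    have htI : t ∈ Icc 0 (π / 2) := ⟨ht.1, ht.2.le⟩
    refine lt_of_le_of_ne (hnn t htI) fun h0 ↦ ?_
    have hle := second_deriv_nonpos_of_max (h := fun s ↦ -(γ a' s).1) ht
      (fun s hs ↦ (hw a' s hs).neg) (fun _ ↦ by simp [hγ0]) (hz a' t).neg
      (fun s hs ↦ by simpa only [← h0, neg_zero, neg_nonpos] using hnn s hs)
    refine hle.not_gt ?_
    have hcos : 0 < cos t := cos_pos_of_mem_Ioo ⟨by linarith [ht.1], ht.2⟩
    have htr : truncate M 0 = 0 := truncate_of_abs_le (by simpa using hM)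
    have hval : -(truncField ε lam M N t (γ a' t)).2 = cos t / ε ^ 2 := by
      simp only [truncField, ← h0, htr]
      ring
    rw [hval]
    positivity
  have hend : (γ a' (π / 2)).1 = 0 := by
    rcases ht₀.2.eq_or_lt with h | h
    · exact le_antisymm (h ▸ hat₀) (hnn _ ⟨hpi.le, le_rfl⟩)
    · exact absurd (hpos t₀ ⟨ht₀.1, h⟩) hat₀.not_gt
  refine ⟨γ a', hγ a', by simp [hγ0], hend, hpos, fun t ht ↦ ⟨?_, hzN a' t ht⟩⟩
  rw [abs_of_nonneg (hnn t ht)]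
  exact (hbelow a' (π / 2) ⟨hpi.le, le_rfl⟩ (hend ▸ hM0) t ht).le

theorem exists_isPhase {ε : ℝ} (hε : 0 < ε) (lam : ℝ) :
    ∃ w z : ℝ → ℝ, IsPhase ε lam w z ∧ z 0 = 0 ∧ w (π / 2) = 0 ∧
      (∀ t ∈ Ico 0 (π / 2), 0 < w t) ∧ (∀ t, w (-t) = w t) ∧ ∀ t, w (π - t) = -w t := by
  obtain ⟨M, hM, hMlam⟩ : ∃ M : ℝ, 0 ≤ M ∧ 1 < M ^ 3 - lam * M := by
    refine ⟨|lam| + 2, by positivity, ?_⟩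
    nlinarith [abs_nonneg lam, le_abs_self lam, sq_nonneg |lam|, pow_nonneg (abs_nonneg lam) 3]
  obtain ⟨γ, hγ, hz0, hend, hpos, hbd⟩ := exists_shooting hε hM hMlam rfl
  set N := 2 * ((M ^ 3 + |lam| * M + 1) / ε ^ 2)
  have hN0 : 0 ≤ N := by positivity
  have heven : (fun t ↦ ((γ (-t)).1, -(γ (-t)).2)) = γ := by
    refine truncField_solution_unique hM (t₀ := 0) (fun t ↦ ?_) hγ
      (by ext <;> simp [hz0])
    have h := (hγ (-t)).scomp t (hasDerivAt_neg t)
    have h1 : HasDerivAt (fun t ↦ (γ (-t)).1) _ t := h.fst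
    have h2 : HasDerivAt (fun t ↦ (γ (-t)).2) _ t := h.snd
    refine (h1.prodMk h2.neg).congr_deriv ?_
    simp [truncField, truncate_neg hN0]
  have hodd : (fun t ↦ (-(γ (π - t)).1, (γ (π - t)).2)) = γ := by
    refine truncField_solution_unique hM (t₀ := π / 2) (fun t ↦ ?_) hγ
      (by ext <;> simp [sub_half, hend])
    have h := (hγ (π - t)).scomp t ((hasDerivAt_id t).const_sub π)
    have h1 : HasDerivAt (fun t ↦ (γ (π - t)).1) _ t := h.fst
    have h2 : HasDerivAt (fun t ↦ (γ (π - t)).2) _ t := h.snd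
    refine (h1.neg.prodMk h2).congr_deriv ?_
    simp [truncField, truncate_neg hM, cos_pi_sub]
    ring
  have hw1 : ∀ t, (γ (-t)).1 = (γ t).1 := fun t ↦ by
    simpa only using congrArg Prod.fst (congrFun heven t)
  have hz1 : ∀ t, -(γ (-t)).2 = (γ t).2 := fun t ↦ by
    simpa only using congrArg Prod.snd (congrFun heven t)
  have hw2 : ∀ t, -(γ (π - t)).1 = (γ t).1 := fun t ↦ by
    simpa only using congrArg Prod.fst (congrFun hodd t)
  have hz2 : ∀ t, (γ (π - t)).2 = (γ t).2 := fun t ↦ by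
    simpa only using congrArg Prod.snd (congrFun hodd t)
  have hper : Function.Periodic (fun t ↦ (|(γ t).1|, |(γ t).2|)) π := by
    intro t
    have h1 := hw2 (-t)
    have h2 := hz2 (-t)
    rw [sub_neg_eq_add, add_comm] at h1 h2
    simp only [← abs_neg (γ (t + π)).1, h1, h2, hw1, ← hz1 t, abs_neg]
  have hbd' : ∀ t, |(γ t).1| ≤ M ∧ |(γ t).2| ≤ N := by
    intro t
    obtain ⟨y, hy, hty⟩ := hper.exists_mem_Ico₀ pi_pos t
    simp only [Prod.mk.injEq] at hty
    rw [hty.1, hty.2]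
    rcases le_total y (π / 2) with h | h
    · exact hbd y ⟨hy.1, h⟩
    · rw [← hw2, ← hz2, abs_neg]
      exact hbd (π - y) ⟨by linarith [hy.2], by linarith⟩
  refine ⟨fun t ↦ (γ t).1, fun t ↦ (γ t).2, fun t ↦ ?_, hz0, hend, hpos, hw1,
    fun t ↦ by simp only [← hw2 t, neg_neg]⟩
  have h := hγ t
  rw [truncField, truncate_of_abs_le (hbd' t).1, truncate_of_abs_le (hbd' t).2] at h
  exact ⟨h.fst, h.snd⟩

theorem IsDuffingSol.isPhase_neg {ε lam : ℝ} (hε : 0 < ε) {u : ℝ → ℝ}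
    (h : IsDuffingSol ε lam u) : IsPhase ε lam (fun t ↦ -u t) fun t ↦ -deriv u t := by
  intro t
  have h1 : Differentiable ℝ u := h.1.differentiable (by norm_num)
  have h2 : Differentiable ℝ (deriv u) := by
    have h' : ContDiff ℝ (1 + 1) u := by
      rw [one_add_one_eq_two]
      exact h.1
    exact (contDiff_succ_iff_deriv.1 h').2.2.differentiable one_ne_zero
  refine ⟨(h1 t).hasDerivAt.neg, (h2 t).hasDerivAt.neg.congr_deriv ?_⟩
  rw [eq_div_iff (by positivity)]
  linarith [h.2 t]

theorem IsPhase.isDuffingSol_neg {ε lam : ℝ} (hε : 0 < ε) {w z : ℝ → ℝ}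
    (h : IsPhase ε lam w z) : IsDuffingSol ε lam fun t ↦ -w t := by
  have hd1 : deriv (fun t ↦ -w t) = fun t ↦ -z t := funext fun t ↦ (h t).1.neg.deriv
  have hd2 : deriv (fun t ↦ -z t) = fun t ↦ -((w t ^ 3 - lam * w t - cos t) / ε ^ 2) :=
    funext fun t ↦ (h t).2.neg.deriv
  have hw : Continuous w := continuous_iff_continuousAt.2 fun t ↦ (h t).1.continuousAt
  refine ⟨?_, fun t ↦ ?_⟩
  · rw [← one_add_one_eq_two, contDiff_succ_iff_deriv, hd1, contDiff_one_iff_deriv, hd2]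
    exact ⟨fun t ↦ (h t).1.neg.differentiableAt, by simp,
      fun t ↦ (h t).2.neg.differentiableAt, by fun_prop⟩
  · rw [hd1, hd2]
    field_simp
    ring

/-- For every `ε > 0` and every real `λ` there is exactly one solution `u` of the
Duffing equation on `ℝ` with `u'(0) = 0`, `u(π/2) = 0` and `u' > 0` on `(0,π/2)`;
moreover it satisfies `u(0) < 0`, is antisymmetric about `π/2`, and is `2π`-periodic. -/
theorem stmt_4 (ε lam : ℝ) (hε : 0 < ε) :
    ∃ u : ℝ → ℝ,
      (IsDuffingSol ε lam u ∧ deriv u 0 = 0 ∧ u (π / 2) = 0 ∧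
        ∀ t ∈ Ioo (0 : ℝ) (π / 2), 0 < deriv u t) ∧
      (u 0 < 0 ∧ (∀ t : ℝ, u (π / 2 + t) = -u (π / 2 - t)) ∧
        Function.Periodic u (2 * π)) ∧
      (∀ v : ℝ → ℝ,
        (IsDuffingSol ε lam v ∧ deriv v 0 = 0 ∧ v (π / 2) = 0 ∧
          ∀ t ∈ Ioo (0 : ℝ) (π / 2), 0 < deriv v t) → v = u) := by
  obtain ⟨w, z, h, hz, he, hp, heven, hodd⟩ := exists_isPhase hε lam
  have hd : ∀ t, deriv (fun t ↦ -w t) t = -z t := fun t ↦ (h t).1.neg.deriv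
  refine ⟨fun t ↦ -w t, ⟨h.isDuffingSol_neg hε, by rw [hd, hz, neg_zero], by simp [he], ?_⟩,
    ⟨?_, ?_, ?_⟩, ?_⟩
  · intro t ht
    rw [hd]
    exact neg_pos.2 (isPhase_velocity_neg hε h hz he hp t ht)
  · exact neg_neg_of_pos (hp 0 ⟨le_rfl, pi_div_two_pos⟩)
  · intro t
    have := hodd (π / 2 - t)
    rw [show π - (π / 2 - t) = π / 2 + t by ring] at this
    simp only [this]
  · intro t
    have h1 := hodd (-(t + π))
    have h2 := hodd (-t)
    rw [heven] at h1 h2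
    rw [sub_neg_eq_add, add_comm] at h1 h2
    rw [show t + π + π = t + 2 * π by ring] at h1
    simp only [h1, h2, neg_neg]
  · rintro v ⟨hv, hv0, hve, hvpos⟩
    have hvp := hv.isPhase_neg hε
    have hvz : -deriv v 0 = 0 := by rw [hv0, neg_zero]
    have hvneg : ∀ t ∈ Ico 0 (π / 2), 0 < -v t := by
      intro t ht
      have hmono : StrictMonoOn v (Icc 0 (π / 2)) := by
        refine strictMonoOn_of_deriv_pos (convex_Icc _ _) hv.1.continuous.continuousOn ?_
        rwa [interior_Icc]
      have := hmono ⟨ht.1, ht.2.le⟩ (right_mem_Icc.2 pi_div_two_pos.le) ht.2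
      linarith
    have h0 : -v 0 = w 0 := le_antisymm
      (isPhase_initial_le hε hvp h hvz hz (by rw [hve, neg_zero]) he hp)
      (isPhase_initial_le hε h hvp hz hvz he (by rw [hve, neg_zero]) hvneg)
    have heq := isPhase_unique hvp h h0 (hvz.trans hz.symm)
    ext t
    rw [← congrFun heq t, neg_neg]
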